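/- Let A ∈ ℝ^{m×n} and let X ∈ ℝ^{n×p} have full row rank n. Let X Xᵀ = P Λ Pᵀ be a spectral decomposition with P orthogonal and Λ diagonal with positive diagonal entries, and set S = P Λ^{1/2}. Let A S = Σ_{i=1}^r σ_i u_i v_iᵀ be an SVD of A S with r = rank(A S). For 1 ≤ k ≤ r define Ã_k = (Σ_{i=1}^k σ_i u_i v_iᵀ) S^{-1}. Then ‖(A − Ã_k) X‖_F² = Σ_{i=k+1}^r σ_i². -/

import Mathlib

open Matrix Finset

/-- Frobenius norm of a real matrix. -/
noncomputable def frob {m n : ℕ} (M : Matrix (Fin m) (Fin n) ℝ) : ℝ :=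
  Real.sqrt (∑ i, ∑ j, (M i j) ^ 2)

theorem frob_sq {m n : ℕ} (M : Matrix (Fin m) (Fin n) ℝ) :
    frob M ^ 2 = (M * Mᵀ).trace := by
  have h : 0 ≤ ∑ i, ∑ j, M i j ^ 2 :=
    Finset.sum_nonneg fun i _ => Finset.sum_nonneg fun j _ => sq_nonneg _
  refine (Real.sq_sqrt h).trans ?_
  simp [Matrix.trace, Matrix.mul_apply, sq]

/-- The squared Frobenius norm of `M * X` depends on `X` only through `X * Xᵀ`. -/
theorem frob_mul_sq_congr {m n p q : ℕ} (M : Matrix (Fin m) (Fin n) ℝ)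
    {X : Matrix (Fin n) (Fin p) ℝ} {S : Matrix (Fin n) (Fin q) ℝ} (h : X * Xᵀ = S * Sᵀ) :
    frob (M * X) ^ 2 = frob (M * S) ^ 2 := by
  rw [frob_sq, frob_sq, transpose_mul, transpose_mul, Matrix.mul_assoc, ← Matrix.mul_assoc X, h,
    Matrix.mul_assoc M, Matrix.mul_assoc S]

/-- The squared Frobenius norm of a sum of rank-one matrices built from orthonormal families. -/
theorem frob_sum_smul_vecMulVec_sq {ι : Type*} [DecidableEq ι] {m n : ℕ} (s : Finset ι)
    (σ : ι → ℝ) (u : ι → Fin m → ℝ) (v : ι → Fin n → ℝ)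
    (hu : ∀ i j, (∑ x, u i x * u j x) = if i = j then (1 : ℝ) else 0)
    (hv : ∀ i j, (∑ x, v i x * v j x) = if i = j then (1 : ℝ) else 0) :
    frob (∑ i ∈ s, σ i • vecMulVec (u i) (v i)) ^ 2 = ∑ i ∈ s, σ i ^ 2 := by
  have hu' : ∀ i j, u i ⬝ᵥ u j = if i = j then (1 : ℝ) else 0 := hu
  have hv' : ∀ i j, v i ⬝ᵥ v j = if i = j then (1 : ℝ) else 0 := hv
  rw [frob_sq, transpose_sum, Matrix.sum_mul, trace_sum]
  refine Finset.sum_congr rfl fun i hi => ?_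
  rw [Matrix.mul_sum, trace_sum, Finset.sum_eq_single_of_mem i hi]
  · simp [transpose_vecMulVec, vecMulVec_mul_vecMulVec, trace_vecMulVec, hu', hv', sq]
  · intro j _ hji
    simp [transpose_vecMulVec, vecMulVec_mul_vecMulVec, hv', hji.symm]

/-- ASVD-II, rank-`k` truncation: with `S = P Λ^{1/2}` from a spectral decomposition
`X Xᵀ = P Λ Pᵀ` and an SVD of `A S`, truncating the trailing singular values gives squared
loss `Σ_{i>k} σ_i²`. -/
theorem asvd_spectral_truncation_sq_loss
    (m n p r k : ℕ) (A : Matrix (Fin m) (Fin n) ℝ)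
    (X : Matrix (Fin n) (Fin p) ℝ) (hX : X.rank = n)
    (P : Matrix (Fin n) (Fin n) ℝ) (d : Fin n → ℝ)
    (hP : Pᵀ * P = 1) (hd : ∀ i, 0 < d i)
    (hspec : X * Xᵀ = P * Matrix.diagonal d * Pᵀ)
    (S : Matrix (Fin n) (Fin n) ℝ)
    (hSdef : S = P * Matrix.diagonal (fun i => Real.sqrt (d i)))
    (σ : Fin r → ℝ) (u : Fin r → Fin m → ℝ) (v : Fin r → Fin n → ℝ)
    (hr : (A * S).rank = r)
    (hσpos : ∀ i, 0 < σ i)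
    (hσanti : ∀ i j : Fin r, i ≤ j → σ j ≤ σ i)
    (hu : ∀ i j : Fin r, (∑ x, u i x * u j x) = if i = j then (1 : ℝ) else 0)
    (hv : ∀ i j : Fin r, (∑ x, v i x * v j x) = if i = j then (1 : ℝ) else 0)
    (hAS : A * S = ∑ i : Fin r, σ i • vecMulVec (u i) (v i))
    (hk1 : 1 ≤ k) (hkr : k ≤ r)
    (Ak : Matrix (Fin m) (Fin n) ℝ)
    (hAk : Ak = (∑ i ∈ Finset.univ.filter (fun i : Fin r => (i : ℕ) < k),
        σ i • vecMulVec (u i) (v i)) * S⁻¹) :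
    frob ((A - Ak) * X) ^ 2 =
      ∑ i ∈ Finset.univ.filter (fun i : Fin r => k ≤ (i : ℕ)), σ i ^ 2 := by
  have hSS : X * Xᵀ = S * Sᵀ := by
    rw [hspec, hSdef, transpose_mul, diagonal_transpose, ← Matrix.mul_assoc,
      Matrix.mul_assoc P (diagonal _) (diagonal _), diagonal_mul_diagonal]
    simp only [Real.mul_self_sqrt (hd _).le]
  have hSunit : IsUnit S.det := by
    rw [hSdef, det_mul, det_diagonal]
    refine (isUnit_det_of_left_inverse hP).mul (isUnit_iff_ne_zero.mpr ?_)
    exact Finset.prod_ne_zero_iff.mpr fun i _ => (Real.sqrt_pos.mpr (hd i)).ne'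
  have hres : (A - Ak) * S =
      ∑ i ∈ Finset.univ.filter (fun i : Fin r => k ≤ (i : ℕ)), σ i • vecMulVec (u i) (v i) := by
    rw [Matrix.sub_mul, hAk, nonsing_inv_mul_cancel_right _ _ hSunit, hAS, sub_eq_iff_eq_add',
      ← Finset.sum_filter_add_sum_filter_not _ (fun i : Fin r => (i : ℕ) < k)]
    simp only [not_lt]
  rw [frob_mul_sq_congr _ hSS, hres, frob_sum_smul_vecMulVec_sq _ σ u v hu hv]
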